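/- Every perfect trace of the 2-player Hanabi bookkeeping model has length at most 71. -/

import Mathlib

/-- A state of the Hanabi bookkeeping model:
`m` hint tokens, `d` cards left in the deck, `q` remaining turns once the
deck is empty, `f` completed fireworks, `s` score. -/
structure HState where
  m : ℕ
  d : ℕ
  q : ℕ
  f : ℕ
  s : ℕ

/-- The invariants a state must satisfy. -/
def HState.valid (st : HState) : Prop :=
  st.m ≤ 8 ∧ st.f ≤ 5 ∧ 5 * st.f ≤ st.s ∧ st.s ≤ 20 + st.f

/-- The possible kinds of turns. -/
inductive HAction where
  | hint | discard | playFail | playSucc | playComplete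
deriving DecidableEq

/-- Is the action a play (successful or not, possibly firework-completing)? -/
def HAction.isPlay : HAction → Prop
  | .hint => False
  | .discard => False
  | _ => True

instance : DecidablePred HAction.isPlay := by
  intro a; cases a <;> simp [HAction.isPlay] <;> infer_instance

/-- A turn of kind `a` from state `st` to state `st'`. -/
def Step (a : HAction) (st st' : HState) : Prop :=
  st.valid ∧ st'.valid ∧
  -- a turn is allowed only if the score is below 25 and the game is not over
  st.s < 25 ∧ (1 ≤ st.d ∨ 1 ≤ st.q) ∧
  -- update of the deck size and of the remaining-turns counter
  st'.d = (if 1 ≤ st.d ∧ a ≠ .hint then st.d - 1 else st.d) ∧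
  st'.q = (if st.d = 0 then st.q - 1 else st.q) ∧
  -- effect of the individual actions
  (match a with
  | .hint => 1 ≤ st.m ∧ st'.m = st.m - 1 ∧ st'.f = st.f ∧ st'.s = st.s
  | .discard => st.m ≤ 7 ∧ st'.m = st.m + 1 ∧ st'.f = st.f ∧ st'.s = st.s
  | .playFail => st'.m = st.m ∧ st'.f = st.f ∧ st'.s = st.s
  | .playSucc => st'.m = st.m ∧ st'.f = st.f ∧ st'.s = st.s + 1
  | .playComplete =>
      st.f ≤ 4 ∧ st'.m = min (st.m + 1) 8 ∧ st'.f = st.f + 1 ∧ st'.s = st.s + 1)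

/-- Hand size for `p` players. -/
def handSize (p : ℕ) : ℕ := if p ≤ 3 then 5 else 4

/-- Initial deck size for `p` players. -/
def initialDeck (p : ℕ) : ℕ := 50 - p * handSize p

/-- The initial state for `p` players. -/
def initState (p : ℕ) : HState := ⟨8, initialDeck p, p, 0, 0⟩

/-- A trace of length `n` (i.e. with `n` turns) of the `p`-player Hanabi
bookkeeping model: `n + 1` states starting at the initial state, with
consecutive states related by turns. -/
structure Trace (p n : ℕ) where
  state : Fin (n + 1) → HState
  action : Fin n → HAction
  init : state 0 = initState p
  step : ∀ t : Fin n, Step (action t) (state t.castSucc) (state t.succ)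

/-- A bound on the number `t` of turns played when a two-player game reaches the state `st`:
a potential estimate until the first turn with an empty deck, and thereafter bounds on `t`
for those states from which a perfect score is still possible. -/
def HState.TurnBound (st : HState) (t : ℕ) : Prop :=
  st.q ≤ 2 ∧ (st.q < 2 → st.d = 0) ∧
  (st.q = 2 → t + st.m + 2 * st.d + st.s ≤ 88 + st.f) ∧
  (st.q = 1 → 24 ≤ st.s → t ≤ 70) ∧
  (st.q = 0 → 25 ≤ st.s → t ≤ 71)

theorem initState_two_turnBound : (initState 2).TurnBound 0 := by
  simp [HState.TurnBound, initState, initialDeck, handSize]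

theorem Step.turnBound {a : HAction} {st st' : HState} {t : ℕ} (h : Step a st st')
    (ht : st.TurnBound t) : st'.TurnBound (t + 1) := by
  obtain ⟨hv, -, hs, hdq, hd, hq, ha⟩ := h
  unfold HState.TurnBound at ht ⊢
  unfold HState.valid at hv
  cases a <;>
    simp only [ne_eq, reduceCtorEq, not_true_eq_false, not_false_eq_true, and_true, and_false,
      if_false] at hd ha <;>
    split_ifs at hd hq <;> omega

theorem Trace.turnBound {n : ℕ} (tr : Trace 2 n) (t : Fin (n + 1)) :
    (tr.state t).TurnBound t := by
  induction t using Fin.induction with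
  | zero => simpa [tr.init] using initState_two_turnBound
  | succ i ih => simpa using (tr.step i).turnBound ih

theorem Trace.valid {p n : ℕ} (tr : Trace p n) (t : Fin (n + 1)) : (tr.state t).valid := by
  cases t using Fin.cases with
  | zero => simp [tr.init, initState, HState.valid]
  | succ i => exact (tr.step i).2.1

/-- Every perfect trace (final score 25) of the 2-player Hanabi bookkeeping
model has length at most 71. -/
theorem hanabi_two_player_perfect_max_length (n : ℕ) (tr : Trace 2 n)
    (hperfect : (tr.state (Fin.last n)).s = 25) : n ≤ 71 := by
  have hv := tr.valid (Fin.last n)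
  have hb := tr.turnBound (Fin.last n)
  simp only [HState.TurnBound, HState.valid, Fin.val_last] at hv hb
  omega
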